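/- Let ρ : ℂ^n → ℝ be a C^∞ function such that G = {z ∈ ℂ^n : ρ(z) ≤ 0} is compact, the real differential dρ does not vanish at any point of bG = {z : ρ(z) = 0}, and G is linearly convex. Then for every ζ ∈ bG and every z ∈ ℂ^n with ρ(z) < 0 one has Σ_{j=1}^n (∂ρ/∂ζ_j)(ζ) · (ζ_j − z_j) ≠ 0, i.e. the complex tangent hyperplane {z : Σ_{j=1}^n (∂ρ/∂ζ_j)(ζ)(ζ_j − z_j) = 0} at any boundary point ζ does not meet the interior of G. -/

import Mathlib

open scoped BigOperators

/-- The Wirtinger derivative `∂ρ/∂ζ_j = ½(∂ρ/∂x_j − i ∂ρ/∂y_j)` of a real-valued `C^∞`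
function `ρ` on `ℂ^n`, computed from its real Fréchet derivative. -/
noncomputable def wirtingerDeriv (n : ℕ) (ρ : (Fin n → ℂ) → ℝ) (j : Fin n)
    (ζ : Fin n → ℂ) : ℂ :=
  (1 / 2 : ℂ) * ((fderiv ℝ ρ ζ (Pi.single j 1) : ℂ) -
    Complex.I * (fderiv ℝ ρ ζ (Pi.single j Complex.I) : ℂ))

open Filter Topology in
/-- If `Dh < 0` then `ρ` is negative at `ζ + t h` for arbitrarily small `t > 0`;
stated for an arbitrary real function. -/
lemma eventually_neg_of_fderiv_neg {n : ℕ} {ρ : (Fin n → ℂ) → ℝ} {ζ h : Fin n → ℂ}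
    (hd : DifferentiableAt ℝ ρ ζ) (h0 : ρ ζ = 0) (hneg : fderiv ℝ ρ ζ h < 0) :
    ∀ᶠ t : ℝ in 𝓝[>] 0, ρ (ζ + t • h) < 0 := by
  have h1 : HasDerivAt (fun t : ℝ => ρ (ζ + t • h)) (fderiv ℝ ρ ζ h) 0 :=
    hd.hasFDerivAt.hasLineDerivAt h
  have h2 := (hasDerivAt_iff_tendsto_slope.1 h1).eventually_lt_const hneg
  have h3 : 𝓝[>] (0 : ℝ) ≤ 𝓝[≠] 0 := nhdsWithin_mono _ (fun x hx => ne_of_gt hx)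
  filter_upwards [h3 h2, self_mem_nhdsWithin] with t ht ht0
  have htpos : 0 < t := ht0
  simp only [slope_def_field, zero_smul, add_zero, h0, sub_zero] at ht
  by_contra hc
  exact absurd ht (not_lt.2 (div_nonneg (not_lt.1 hc) htpos.le))

/-- `Dh = 2 Re L h`. -/
lemma fderiv_eq_wirtinger {n : ℕ} (ρ : (Fin n → ℂ) → ℝ) (ζ h : Fin n → ℂ) :
    fderiv ℝ ρ ζ h = 2 * (∑ j : Fin n, wirtingerDeriv n ρ j ζ * h j).re := by
  have e : h = ∑ j : Fin n, ((h j).re • (Pi.single j 1 : Fin n → ℂ)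
      + (h j).im • (Pi.single j Complex.I : Fin n → ℂ)) := by
    conv_lhs => rw [← Finset.univ_sum_single h]
    refine Finset.sum_congr rfl fun j _ => ?_
    rw [← Pi.single_smul, ← Pi.single_smul, ← Pi.single_add]
    congr 1
    apply Complex.ext <;> simp
  conv_lhs => rw [e]
  rw [map_sum, Complex.re_sum, Finset.mul_sum]
  refine Finset.sum_congr rfl fun j _ => ?_
  rw [map_add, map_smul, map_smul]
  simp [wirtingerDeriv]
  ring

open Filter Topology in
/-- A supporting complex hyperplane at the boundary point. -/
lemma exists_support {n : ℕ} (ρ : (Fin n → ℂ) → ℝ) (hc : Continuous ρ)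
    (ζ : Fin n → ℂ) (h0 : ρ ζ = 0) (hd : DifferentiableAt ℝ ρ ζ) (hD : fderiv ℝ ρ ζ ≠ 0)
    (hlinconv : ∀ z : Fin n → ℂ, ¬ (ρ z ≤ 0) →
      ∃ ξ : ℂ × (Fin n → ℂ),
        ξ.1 + ∑ j : Fin n, ξ.2 j * z j = 0 ∧
        ∀ u : Fin n → ℂ, ρ u ≤ 0 → ξ.1 + ∑ j : Fin n, ξ.2 j * u j ≠ 0) :
    ∃ a : Fin n → ℂ, ∀ u, ρ u < 0 → a ⬝ᵥ (u - ζ) ≠ 0 := by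
  obtain ⟨v, hv⟩ : ∃ v, 0 < fderiv ℝ ρ ζ v := by
    obtain ⟨v, hv⟩ := DFunLike.ne_iff.1 hD
    rcases lt_or_gt_of_ne hv with h | h
    · exact ⟨-v, by simpa using h⟩
    · exact ⟨v, h⟩
  have hev : ∀ᶠ t : ℝ in 𝓝[>] 0, 0 < ρ (ζ + t • v) := by
    have := eventually_neg_of_fderiv_neg (ρ := fun x => - ρ x) (ζ := ζ) (h := v) hd.neg
      (by simp [h0]) (by rw [fderiv_fun_neg]; simpa using hv)
    simpa using this
  have key : ∀ x, 0 < ρ x → ∃ a : Fin n → ℂ, ‖a‖ = 1 ∧ ∀ u, ρ u ≤ 0 → a ⬝ᵥ (u - x) ≠ 0 := by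
    intro x hx
    obtain ⟨⟨c, b⟩, h1, h2⟩ := hlinconv x (not_le.2 hx)
    have h3 : ∀ u, ρ u ≤ 0 → b ⬝ᵥ (u - x) ≠ 0 := by
      intro u hu h
      apply h2 u hu
      rw [dotProduct_sub, sub_eq_zero] at h
      simp only [dotProduct] at h
      simpa [h] using h1
    have hb : b ≠ 0 := by
      rintro rfl
      exact h3 ζ h0.le (by simp)
    have hbnorm : ‖b‖ ≠ 0 := norm_ne_zero_iff.2 hb
    refine ⟨(‖b‖⁻¹ : ℝ) • b, by rw [norm_smul]; simp [hbnorm], fun u hu => ?_⟩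
    rw [smul_dotProduct]
    exact smul_ne_zero (inv_ne_zero hbnorm) (h3 u hu)
  obtain ⟨t, ht⟩ := exists_seq_forall_of_frequently hev.frequently
  choose a ha1 ha2 using fun k => key _ (ht.2 k)
  obtain ⟨α, hα, φ, hφ, hlim⟩ := (isCompact_sphere (0 : Fin n → ℂ) 1).tendsto_subseq
    (x := a) (fun k => by simpa using ha1 k)
  refine ⟨α, fun u hu hzero => ?_⟩
  obtain ⟨j, hj⟩ : ∃ j, α j ≠ 0 := by
    by_contra! hh
    have : α = 0 := funext hh
    simp [this] at hα
  have ht0 : Tendsto (fun k => t (φ k)) atTop (𝓝 0) :=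
    (tendsto_nhds_of_tendsto_nhdsWithin ht.1).comp hφ.tendsto_atTop
  have hjl : Tendsto (fun k => a (φ k) j) atTop (𝓝 (α j)) := (tendsto_pi_nhds.1 hlim) j
  have hz : Tendsto (fun k => u - (ζ + t (φ k) • v)) atTop (𝓝 (u - ζ)) := by
    simpa using tendsto_const_nhds.sub (tendsto_const_nhds.add (ht0.smul_const v))
  have hdot : Tendsto (fun k => a (φ k) ⬝ᵥ (u - (ζ + t (φ k) • v))) atTop (𝓝 0) := by
    rw [← hzero]
    simp only [dotProduct]
    exact tendsto_finsetSum _ fun i _ =>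
      ((tendsto_pi_nhds.1 hlim) i).mul ((tendsto_pi_nhds.1 hz) i)
  have hcl : Tendsto (fun k => u - (a (φ k) ⬝ᵥ (u - (ζ + t (φ k) • v)) / a (φ k) j) •
      (Pi.single j 1 : Fin n → ℂ)) atTop (𝓝 u) := by
    simpa using tendsto_const_nhds.sub
      ((hdot.div hjl hj).smul_const (Pi.single j 1 : Fin n → ℂ))
  have e1 := ((hc.tendsto u).comp hcl).eventually_lt_const hu
  obtain ⟨k, hk1, hk2⟩ := (e1.and (hjl.eventually_ne hj)).exists
  refine ha2 (φ k) _ hk1.le ?_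
  rw [sub_right_comm, dotProduct_sub, dotProduct_smul]
  simp [hk2]

/-- For a smoothly bounded linearly convex compact `G = {ρ ≤ 0}`, the complex tangent
hyperplane at any boundary point `ζ` does not meet the interior of `G`:
`Σ_j ∂ρ/∂ζ_j(ζ)(ζ_j − z_j) ≠ 0` for `ζ ∈ bG` and `ρ(z) < 0`. -/
theorem tangent_hyperplane_misses_interior (n : ℕ)
    (ρ : (Fin n → ℂ) → ℝ) (hρ : ContDiff ℝ (⊤ : ℕ∞) ρ)
    (hGcompact : IsCompact {z : Fin n → ℂ | ρ z ≤ 0})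
    (hdρ : ∀ z : Fin n → ℂ, ρ z = 0 → fderiv ℝ ρ z ≠ 0)
    (hlinconv : ∀ z : Fin n → ℂ, ¬ (ρ z ≤ 0) →
      ∃ ξ : ℂ × (Fin n → ℂ),
        ξ.1 + ∑ j : Fin n, ξ.2 j * z j = 0 ∧
        ∀ u : Fin n → ℂ, ρ u ≤ 0 → ξ.1 + ∑ j : Fin n, ξ.2 j * u j ≠ 0) :
    ∀ ζ : Fin n → ℂ, ρ ζ = 0 →
      ∀ z : Fin n → ℂ, ρ z < 0 →
        ∑ j : Fin n, wirtingerDeriv n ρ j ζ * (ζ j - z j) ≠ 0 := by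
  intro ζ h0 z hz hL
  have hd : DifferentiableAt ℝ ρ ζ := (hρ.differentiable (by simp)) ζ
  obtain ⟨a, ha⟩ := exists_support ρ hρ.continuous ζ h0 hd (hdρ ζ h0) hlinconv
  set L : Fin n → ℂ := fun j => wirtingerDeriv n ρ j ζ with hLdef
  have hDL : ∀ h, fderiv ℝ ρ ζ h = 2 * (L ⬝ᵥ h).re := fun h => fderiv_eq_wirtinger ρ ζ h
  have hx : L ⬝ᵥ (z - ζ) = 0 := by
    have : L ⬝ᵥ (ζ - z) = 0 := hL
    rw [← neg_sub, dotProduct_neg, this, neg_zero]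
  have hax := ha z hz
  -- `D` is nonnegative on the kernel of `a`
  have hge : ∀ h, a ⬝ᵥ h = 0 → 0 ≤ fderiv ℝ ρ ζ h := by
    intro h hh
    by_contra hc
    obtain ⟨t, ht⟩ := (eventually_neg_of_fderiv_neg hd h0 (not_le.1 hc)).exists
    apply ha _ ht
    rw [add_sub_cancel_left, dotProduct_smul, hh, smul_zero]
  have hzero : ∀ h, a ⬝ᵥ h = 0 → fderiv ℝ ρ ζ h = 0 := by
    intro h hh
    refine le_antisymm ?_ (hge h hh)
    have := hge (-h) (by rw [dotProduct_neg, hh, neg_zero])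
    rw [map_neg] at this
    linarith
  apply hdρ ζ h0
  ext v
  have h1 := hzero (v - (a ⬝ᵥ v / a ⬝ᵥ (z - ζ)) • (z - ζ)) (by
    rw [dotProduct_sub, dotProduct_smul, smul_eq_mul, div_mul_cancel₀ _ hax, sub_self])
  rw [hDL, dotProduct_sub, dotProduct_smul, hx, smul_zero, sub_zero, ← hDL] at h1
  simpa using h1
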